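/- arXiv:1407.4288 — 2 statements merged into one kernel-verified Lean document; each statement's English description precedes it below -/
import Mathlib

section
/- Let S₁ and S₂ be two interval posets (families of subsets of a finite set N that arise as P_{[α,β]} for intervals of antichains) such that no X₁ ∈ S₁ and X₂ ∈ S₂ satisfy X₁ ⊆ X₂ or X₂ ⊆ X₁. Then S₁ ∪ S₂ is again an interval poset, and the interval it spans satisfies I_{S₁ ∪ S₂} = I_{S₁} ∨ I_{S₂}, where moreover this join of intervals is direct: every antichain in I_{S₁ ∪ S₂} is the join χ₁ ∨ χ₂ of a unique pair χ₁ ∈ I_{S₁}, χ₂ ∈ I_{S₂}. -/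
/-!
Antichains of subsets of a finite universe
(following De Causmaecker & De Wannemacker,
"On the number of antichains of sets in a finite universe").
-/

open scoped Classical

namespace Antichains

variable {V : Type*} [DecidableEq V]

/-- The `max` operator: keep only the non-dominated members of a family of sets. -/
def maxl (S : Finset (Finset V)) : Finset (Finset V) :=
  S.filter fun X => ∀ Y ∈ S, ¬X ⊂ Y

/-- `A` is an antichain of subsets: no two members are in a subset-superset relation. -/
def IsAC (A : Finset (Finset V)) : Prop :=
  ∀ X ∈ A, ∀ Y ∈ A, X ⊆ Y → X = Y

/-- The domination (partial) order on antichains: `acle A B` iff every member of `A`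
is contained in some member of `B`. -/
def acle (A B : Finset (Finset V)) : Prop :=
  ∀ X ∈ A, ∃ Y ∈ B, X ⊆ Y

/-- Strict domination. -/
def aclt (A B : Finset (Finset V)) : Prop :=
  acle A B ∧ ¬acle B A

/-- Join of antichains: `A ∨ B = max (A ∪ B)`. -/
def acjoin (A B : Finset (Finset V)) : Finset (Finset V) :=
  maxl (A ∪ B)

/-- Meet of antichains: `A ∧ B = max {X ∩ Y | X ∈ A, Y ∈ B}`. -/
def acmeet (A B : Finset (Finset V)) : Finset (Finset V) :=
  maxl ((A ×ˢ B).image fun p => p.1 ∩ p.2)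

/-- `X⁻`: the antichain of immediate subsets of `X`. -/
def im (X : Finset V) : Finset (Finset V) :=
  X.image fun x => X.erase x

/-- The interval poset `P_[a,b] = {X | a ∨ {X} ∈ (a,b]}`. -/
noncomputable def iposet [Fintype V] (a b : Finset (Finset V)) : Finset (Finset V) :=
  Finset.univ.filter fun X : Finset V => aclt a (acjoin a {X}) ∧ acle (acjoin a {X}) b

/-- `χ` belongs, as an antichain, to the interval `[a,b]`. -/
def memI (a b χ : Finset (Finset V)) : Prop :=
  IsAC χ ∧ acle a χ ∧ acle χ b

/-- The bottom of the interval canonically spanned by an interval poset `S`. -/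
def ibot (S : Finset (Finset V)) : Finset (Finset V) :=
  maxl (S.biUnion fun X => im X \ S)

/-- The top of the interval canonically spanned by an interval poset `S`. -/
def itop (S : Finset (Finset V)) : Finset (Finset V) :=
  maxl S

/-- `S` is the interval poset of some interval of antichains. -/
def IsIntervalPoset [Fintype V] (S : Finset (Finset V)) : Prop :=
  ∃ a b : Finset (Finset V), IsAC a ∧ IsAC b ∧ acle a b ∧ S = iposet a b

/-- `A` dominates `X`: some member of `A` contains `X`. -/
def Dominates (A : Finset (Finset V)) (X : Finset V) : Prop :=
  ∃ Y ∈ A, X ⊆ Y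

/-- A family of sets is convex if it contains every set between two of its members. -/
def IsConvex (S : Finset (Finset V)) : Prop :=
  ∀ X ∈ S, ∀ Z ∈ S, ∀ Y, X ⊆ Y → Y ⊆ Z → Y ∈ S

lemma Dominates.mono {V : Type*} {A : Finset (Finset V)} {X Y : Finset V} (hY : Dominates A Y)
    (hXY : X ⊆ Y) : Dominates A X :=
  let ⟨Z, hZ, hYZ⟩ := hY
  ⟨Z, hZ, hXY.trans hYZ⟩

lemma dominates_of_mem {V : Type*} {A : Finset (Finset V)} {X : Finset V} (hX : X ∈ A) :
    Dominates A X :=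
  ⟨X, hX, Finset.Subset.refl X⟩

lemma dominates_union {A B : Finset (Finset V)} {X : Finset V} :
    Dominates (A ∪ B) X ↔ Dominates A X ∨ Dominates B X := by
  simp only [Dominates, Finset.mem_union, or_and_right, exists_or]

lemma acle_iff {V : Type*} {A B : Finset (Finset V)} :
    acle A B ↔ ∀ X, Dominates A X → Dominates B X :=
  ⟨fun h _ ⟨Y, hY, hXY⟩ => Dominates.mono (h Y hY) hXY, fun h X hX => h X (dominates_of_mem hX)⟩

lemma isAC_maxl (S : Finset (Finset V)) : IsAC (maxl S) := by
  intro X hX Y hY hXY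
  by_contra hne
  exact (Finset.mem_filter.1 hX).2 Y (Finset.mem_filter.1 hY).1 (hXY.ssubset_of_ne hne)

lemma dominates_maxl {S : Finset (Finset V)} {X : Finset V} :
    Dominates (maxl S) X ↔ Dominates S X := by
  constructor
  · rintro ⟨Y, hY, hXY⟩
    exact ⟨Y, (Finset.mem_filter.1 hY).1, hXY⟩
  · rintro ⟨Y, hY, hXY⟩
    obtain ⟨M, hYM, hM⟩ := S.exists_le_maximal hY
    exact ⟨M, Finset.mem_filter.2 ⟨hM.prop, fun Z hZ hMZ => hM.not_gt hZ hMZ⟩, hXY.trans hYM⟩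

lemma dominates_acjoin {A B : Finset (Finset V)} {X : Finset V} :
    Dominates (acjoin A B) X ↔ Dominates A X ∨ Dominates B X :=
  dominates_maxl.trans dominates_union

lemma IsAC.subset_of_dominates_iff {V : Type*} {A B : Finset (Finset V)} (hA : IsAC A)
    (h : ∀ X, Dominates A X ↔ Dominates B X) : A ⊆ B := by
  intro X hX
  obtain ⟨Y, hY, hXY⟩ := (h X).1 (dominates_of_mem hX)
  obtain ⟨Z, hZ, hYZ⟩ := (h Y).2 (dominates_of_mem hY)
  obtain rfl := hA X hX Z hZ (hXY.trans hYZ)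
  exact hXY.antisymm hYZ ▸ hY

/-- An antichain is determined by the sets it dominates. -/
lemma IsAC.eq_of_dominates_iff {V : Type*} {A B : Finset (Finset V)} (hA : IsAC A) (hB : IsAC B)
    (h : ∀ X, Dominates A X ↔ Dominates B X) : A = B :=
  (hA.subset_of_dominates_iff h).antisymm (hB.subset_of_dominates_iff fun X => (h X).symm)

lemma mem_iposet [Fintype V] {a b : Finset (Finset V)} (hab : acle a b) {X : Finset V} :
    X ∈ iposet a b ↔ ¬Dominates a X ∧ Dominates b X := by
  have hX : ∀ Y, Dominates ({X} : Finset (Finset V)) Y ↔ Y ⊆ X := by simp [Dominates]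
  simp only [iposet, aclt, acle_iff, dominates_acjoin, hX, Finset.mem_filter,
    Finset.mem_univ, true_and]
  rw [acle_iff] at hab
  constructor
  · rintro ⟨⟨-, hna⟩, hb⟩
    refine ⟨fun ha => hna ?_, hb X (Or.inr (Finset.Subset.refl X))⟩
    rintro Y (hY | hY)
    exacts [hY, ha.mono hY]
  · rintro ⟨hna, hb⟩
    refine ⟨⟨fun Y => Or.inl, fun H => hna (H X (Or.inr (Finset.Subset.refl X)))⟩, ?_⟩
    rintro Y (hY | hY)
    exacts [hab Y hY, hb.mono hY]

lemma dominates_itop {S : Finset (Finset V)} {X : Finset V} :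
    Dominates (itop S) X ↔ Dominates S X :=
  dominates_maxl

/-- The bottom of the interval spanned by a convex family dominates exactly the sets that lie
below the family without belonging to it. -/
lemma IsConvex.dominates_ibot {S : Finset (Finset V)} (hS : IsConvex S) {X : Finset V} :
    Dominates (ibot S) X ↔ Dominates S X ∧ X ∉ S := by
  rw [ibot, dominates_maxl]
  constructor
  · rintro ⟨Y, hY, hXY⟩
    simp only [Finset.mem_biUnion, Finset.mem_sdiff, im, Finset.mem_image] at hY
    obtain ⟨Z, hZ, ⟨z, -, rfl⟩, hYS⟩ := hY
    have hXZ := hXY.trans (Finset.erase_subset z Z)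
    exact ⟨⟨Z, hZ, hXZ⟩, fun hX => hYS (hS X hX Z hZ _ hXY (Finset.erase_subset z Z))⟩
  · rintro ⟨⟨Z, hZ, hXZ⟩, hX⟩
    obtain ⟨M, -, hM⟩ := (S.filter (X ⊆ ·)).exists_le_minimal (Finset.mem_filter.2 ⟨hZ, hXZ⟩)
    obtain ⟨hMS, hXM⟩ := Finset.mem_filter.1 hM.prop
    have hne : X ≠ M := fun h => hX (h ▸ hMS)
    obtain ⟨z, hzM, hzX⟩ := Finset.exists_of_ssubset (hXM.ssubset_of_ne hne)
    have hXe : X ⊆ M.erase z := Finset.subset_erase.2 ⟨hXM, hzX⟩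
    refine ⟨M.erase z, ?_, hXe⟩
    simp only [Finset.mem_biUnion, Finset.mem_sdiff, im, Finset.mem_image]
    exact ⟨M, hMS, ⟨z, hzM, rfl⟩, fun he =>
      hM.not_lt (Finset.mem_filter.2 ⟨he, hXe⟩) (Finset.erase_ssubset hzM)⟩

/-- The interval posets are the convex families. -/
lemma isIntervalPoset_iff_isConvex [Fintype V] {S : Finset (Finset V)} :
    IsIntervalPoset S ↔ IsConvex S := by
  constructor
  · rintro ⟨a, b, -, -, hab, rfl⟩ X hX Z hZ Y hXY hYZ
    rw [mem_iposet hab] at *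
    exact ⟨fun hY => hX.1 (hY.mono hXY), hZ.2.mono hYZ⟩
  · intro hS
    have hle : acle (ibot S) (itop S) := by
      rw [acle_iff]
      exact fun X hX => dominates_itop.2 (hS.dominates_ibot.1 hX).1
    refine ⟨ibot S, itop S, isAC_maxl _, isAC_maxl _, hle, ?_⟩
    ext X
    rw [mem_iposet hle, hS.dominates_ibot, dominates_itop]
    have : X ∈ S → Dominates S X := dominates_of_mem
    tauto

lemma IsConvex.union {S T : Finset (Finset V)} (hS : IsConvex S) (hT : IsConvex T)
    (h : ∀ X ∈ S, ∀ Y ∈ T, ¬X ⊆ Y ∧ ¬Y ⊆ X) : IsConvex (S ∪ T) := by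
  intro X hX Z hZ Y hXY hYZ
  rw [Finset.mem_union] at *
  rcases hX with hX | hX <;> rcases hZ with hZ | hZ
  · exact Or.inl (hS X hX Z hZ Y hXY hYZ)
  · exact absurd (hXY.trans hYZ) (h X hX Z hZ).1
  · exact absurd (hXY.trans hYZ) (h Z hZ X hX).2
  · exact Or.inr (hT X hX Z hZ Y hXY hYZ)

lemma IsConvex.memI_iff {S : Finset (Finset V)} (hS : IsConvex S) {χ : Finset (Finset V)} :
    memI (ibot S) (itop S) χ ↔
      IsAC χ ∧ (∀ X, Dominates S X → X ∉ S → Dominates χ X) ∧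
        ∀ X, Dominates χ X → Dominates S X := by
  simp only [memI, acle_iff, hS.dominates_ibot, dominates_itop, and_imp]

lemma dominates_acmeet {A B : Finset (Finset V)} {X : Finset V} :
    Dominates (acmeet A B) X ↔ Dominates A X ∧ Dominates B X := by
  rw [acmeet, dominates_maxl]
  constructor
  · rintro ⟨Y, hY, hXY⟩
    obtain ⟨⟨P, Q⟩, hPQ, rfl⟩ := Finset.mem_image.1 hY
    obtain ⟨hP, hQ⟩ := Finset.mem_product.1 hPQ
    exact ⟨⟨P, hP, hXY.trans Finset.inter_subset_left⟩,
      ⟨Q, hQ, hXY.trans Finset.inter_subset_right⟩⟩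
  · rintro ⟨⟨P, hP, hXP⟩, Q, hQ, hXQ⟩
    exact ⟨P ∩ Q, Finset.mem_image.2 ⟨(P, Q), Finset.mem_product.2 ⟨hP, hQ⟩, rfl⟩,
      Finset.subset_inter hXP hXQ⟩

/-- The component in `I_S` of a join is determined by the join. -/
lemma IsConvex.dominates_iff_of_memI {S : Finset (Finset V)} (hS : IsConvex S)
    {T p q : Finset (Finset V)} (hp : memI (ibot S) (itop S) p)
    (hq : ∀ X, Dominates q X → Dominates T X) (hST : ∀ X ∈ S, ¬Dominates T X) (X : Finset V) :
    Dominates p X ↔ Dominates S X ∧ (X ∈ S → Dominates p X ∨ Dominates q X) := by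
  obtain ⟨-, hl, hu⟩ := hS.memI_iff.1 hp
  have := hl X
  have := hu X
  have := hq X
  have := hST X
  tauto

/-- Lemma 2 of the paper.  If no member of the interval poset `S₁` is
comparable (by inclusion) with a member of the interval poset `S₂`, then `S₁ ∪ S₂` is an
interval poset and the interval it spans is the direct join of the intervals spanned by
`S₁` and `S₂`: every antichain of `I_{S₁ ∪ S₂}` is the join of a unique pair of
antichains from `I_{S₁}` and `I_{S₂}`. -/
theorem statement1 {V : Type*} [DecidableEq V] [Fintype V] (S₁ S₂ : Finset (Finset V))
    (h₁ : IsIntervalPoset S₁) (h₂ : IsIntervalPoset S₂)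
    (h : ∀ X₁ ∈ S₁, ∀ X₂ ∈ S₂, ¬X₁ ⊆ X₂ ∧ ¬X₂ ⊆ X₁) :
    IsIntervalPoset (S₁ ∪ S₂) ∧
    ∀ χ : Finset (Finset V),
      memI (ibot (S₁ ∪ S₂)) (itop (S₁ ∪ S₂)) χ ↔
        ∃! p : Finset (Finset V) × Finset (Finset V),
          memI (ibot S₁) (itop S₁) p.1 ∧ memI (ibot S₂) (itop S₂) p.2 ∧
            χ = acjoin p.1 p.2 := by
  rw [isIntervalPoset_iff_isConvex] at h₁ h₂
  have hc := h₁.union h₂ h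
  have hn₁ : ∀ X ∈ S₁, ¬Dominates S₂ X := fun X hX ⟨Y, hY, hXY⟩ => (h X hX Y hY).1 hXY
  have hn₂ : ∀ X ∈ S₂, ¬Dominates S₁ X := fun X hX ⟨Y, hY, hXY⟩ => (h Y hY X hX).2 hXY
  refine ⟨isIntervalPoset_iff_isConvex.2 hc, fun χ => ⟨fun hχ => ?_, ?_⟩⟩
  · obtain ⟨hac, hl, hu⟩ := hc.memI_iff.1 hχ
    simp only [dominates_union, Finset.mem_union] at hl hu
    refine ⟨(acmeet χ S₁, acmeet χ S₂), ⟨h₁.memI_iff.2 ⟨isAC_maxl _, ?_, ?_⟩,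
      h₂.memI_iff.2 ⟨isAC_maxl _, ?_, ?_⟩, ?_⟩, ?_⟩
    · intro X hX hXS
      exact dominates_acmeet.2 ⟨hl X (Or.inl hX) (by have := hn₂ X; tauto), hX⟩
    · exact fun X hX => (dominates_acmeet.1 hX).2
    · intro X hX hXS
      exact dominates_acmeet.2 ⟨hl X (Or.inr hX) (by have := hn₁ X; tauto), hX⟩
    · exact fun X hX => (dominates_acmeet.1 hX).2
    · refine hac.eq_of_dominates_iff (isAC_maxl _) fun X => ?_
      simp only [dominates_acjoin, dominates_acmeet]
      have := hu X
      tauto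
    · rintro ⟨p, q⟩ ⟨hp, hq, rfl⟩
      have hpu := (h₁.memI_iff.1 hp).2.2
      have hqu := (h₂.memI_iff.1 hq).2.2
      refine Prod.ext (hp.1.eq_of_dominates_iff (isAC_maxl _) fun X => ?_)
        (hq.1.eq_of_dominates_iff (isAC_maxl _) fun X => ?_)
      · have hX := h₁.dominates_iff_of_memI hp hqu hn₁ X
        have := hl X
        have := hn₂ X
        simp only [dominates_acmeet, dominates_acjoin] at *
        tauto
      · have hX := h₂.dominates_iff_of_memI hq hpu hn₂ X
        have := hl X
        have := hn₁ X
        simp only [dominates_acmeet, dominates_acjoin] at *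
        tauto
  · rintro ⟨⟨p, q⟩, ⟨hp, hq, rfl⟩, -⟩
    obtain ⟨-, hpl, hpu⟩ := h₁.memI_iff.1 hp
    obtain ⟨-, hql, hqu⟩ := h₂.memI_iff.1 hq
    refine hc.memI_iff.2 ⟨isAC_maxl _, fun X => ?_, fun X => ?_⟩
    · have := hpl X
      have := hql X
      simp only [dominates_union, dominates_acjoin, Finset.mem_union]
      tauto
    · simp only [dominates_union, dominates_acjoin]
      exact Or.imp (hpu X) (hqu X)

end Antichains
end

section
/- Let α be an antichain of subsets of a finite set N. Then A_N is the union over all subsets χ ⊆ α (each such χ is itself an antichain) of the intervals [χ, (α \ χ)ˇ], and these intervals are pairwise disjoint. Here (α \ χ)ˇ is the largest antichain not dominating any set of α \ χ. -/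
/-!
Antichains of subsets of a finite universe
(following De Causmaecker & De Wannemacker,
"On the number of antichains of sets in a finite universe").
-/

open scoped Classical

namespace Antichains

variable {V : Type*} [DecidableEq V]

/-- `χˇ`: the largest antichain that does not dominate any member of `χ`,
i.e. the antichain of maximal sets containing no member of `χ`. -/
noncomputable def check [Fintype V] (χ : Finset (Finset V)) : Finset (Finset V) :=
  maxl (Finset.univ.filter fun Y : Finset V => ∀ X ∈ χ, ¬X ⊆ Y)

theorem maxl_subset (S : Finset (Finset V)) : maxl S ⊆ S :=
  Finset.filter_subset _ _

theorem exists_mem_maxl_superset {S : Finset (Finset V)} {X : Finset V} (hX : X ∈ S) :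
    ∃ Y ∈ maxl S, X ⊆ Y := by
  obtain ⟨Y, hXY, hY⟩ := S.exists_le_maximal hX
  refine ⟨Y, Finset.mem_filter.2 ⟨hY.prop, fun Z hZ hYZ => ?_⟩, hXY⟩
  exact hY.not_gt hZ hYZ

theorem acle_check_iff [Fintype V] {σ χ : Finset (Finset V)} :
    acle σ (check χ) ↔ ∀ Z ∈ σ, ∀ X ∈ χ, ¬X ⊆ Z := by
  constructor
  · intro h Z hZ X hX hXZ
    obtain ⟨Y, hY, hZY⟩ := h Z hZ
    have hY' := maxl_subset _ hY
    simp only [Finset.mem_filter, Finset.mem_univ, true_and] at hY'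
    exact hY' X hX (hXZ.trans hZY)
  · intro h Z hZ
    refine exists_mem_maxl_superset ?_
    rw [Finset.mem_filter]
    exact ⟨Finset.mem_univ Z, h Z hZ⟩

/-- Theorem 1 of the paper.  For an antichain `a`, the full lattice of
antichains is the disjoint union, over the subsets `χ ⊆ a`, of the intervals
`[χ, (a \ χ)ˇ]`: every antichain lies in exactly one of these intervals. -/
theorem statement7 {V : Type*} [DecidableEq V] [Fintype V] (a : Finset (Finset V))
    (ha : IsAC a) :
    ∀ σ : Finset (Finset V), IsAC σ →
      ∃! χ : Finset (Finset V), χ ⊆ a ∧ acle χ σ ∧ acle σ (check (a \ χ)) := by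
  intro σ _
  simp only [acle_check_iff]
  refine ⟨a.filter fun X => ∃ Y ∈ σ, X ⊆ Y, ⟨Finset.filter_subset _ _, ?_, ?_⟩, ?_⟩
  · exact fun X hX => (Finset.mem_filter.1 hX).2
  · intro Z hZ X hX hXZ
    obtain ⟨hXa, hXσ⟩ := Finset.mem_sdiff.1 hX
    exact hXσ (Finset.mem_filter.2 ⟨hXa, Z, hZ, hXZ⟩)
  · rintro χ ⟨hχa, hχσ, hσ⟩
    ext X
    refine ⟨fun hX => Finset.mem_filter.2 ⟨hχa hX, hχσ X hX⟩, fun hX => ?_⟩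
    obtain ⟨hXa, Y, hY, hXY⟩ := Finset.mem_filter.1 hX
    by_contra hXχ
    exact hσ Y hY X (Finset.mem_sdiff.2 ⟨hXa, hXχ⟩) hXY

end Antichains
end
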